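/- arXiv:0803.1129 — 2 statements merged into one kernel-verified Lean document; each statement's English description precedes it below -/
import Mathlib

section
/- For every n ≥ 1, the expected number of plateaux of a uniformly random Stirling permutation of length 2n equals (2n+1)/3; equivalently, the sum over all Stirling permutations of length 2n of the number of plateaux equals (2n+1)·(2n-1)!!/3. The same holds for the expected numbers of ascents and of descents: E X_n = E Y_n = E Z_n = (2n+1)/3. -/
/-- A Stirling permutation of length `2*n`. -/
def IsStirlingPerm (n : ℕ) (l : List ℕ) : Prop :=
  l.length = 2 * n ∧
  (∀ i : ℕ, 1 ≤ i → i ≤ n → l.count i = 2) ∧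
  ∀ p q r : Fin l.length, p < q → q < r → l.get p = l.get r → l.get p < l.get q

/-- The extended sequence `a_0 a_1 … a_{2n} a_{2n+1}` with the convention
`a_0 = a_{2n+1} = 0`: `ext l i = a_i`. -/
def ext (l : List ℕ) (i : ℕ) : ℕ := if i = 0 then 0 else l.getD (i - 1) 0

/-- The number of ascents of `l`: indices `i ∈ {0,…,2n}` with `a_i < a_{i+1}`. -/
def ascents (l : List ℕ) : ℕ :=
  ((Finset.range (l.length + 1)).filter (fun i => ext l i < ext l (i + 1))).card

/-- The number of descents of `l`: indices `i ∈ {0,…,2n}` with `a_i > a_{i+1}`. -/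
def descents (l : List ℕ) : ℕ :=
  ((Finset.range (l.length + 1)).filter (fun i => ext l i > ext l (i + 1))).card

/-- The number of plateaux of `l`: indices `i ∈ {0,…,2n}` with `a_i = a_{i+1}`. -/
def plateaux (l : List ℕ) : ℕ :=
  ((Finset.range (l.length + 1)).filter (fun i => ext l i = ext l (i + 1))).card

/-- The expectation of a statistic `f` under the uniform distribution on the set of
Stirling permutations of length `2n`. -/
noncomputable def stirlingExp (n : ℕ) (f : List ℕ → ℝ) : ℝ :=
  (∑ᶠ l ∈ {l : List ℕ | IsStirlingPerm n l}, f l)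
    / ({l : List ℕ | IsStirlingPerm n l}.ncard : ℝ)

/-- The list obtained from `l` by inserting two adjacent copies of `v` after the first `k`
entries. -/
def insertTwice (v : ℕ) (l : List ℕ) (k : ℕ) : List ℕ := l.take k ++ v :: v :: l.drop k

/-- The finset of Stirling permutations of length `2 * n`, built by successively inserting the
largest value twice. -/
def stirlingPerms : ℕ → Finset (List ℕ)
  | 0 => {[]}
  | n + 1 => (stirlingPerms n ×ˢ Finset.range (2 * n + 1)).image
      fun p => insertTwice (n + 1) p.1 p.2

theorem isStirlingPerm_iff (n : ℕ) (l : List ℕ) :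
    IsStirlingPerm n l ↔ (l : Multiset ℕ) = 2 • (Finset.Icc 1 n).val ∧
      ∀ a b, [a, b, a].Sublist l → a < b := by
  refine and_assoc.symm.trans (and_congr ⟨fun ⟨hlen, hcount⟩ => ?_, fun h => ⟨?_, ?_⟩⟩ ⟨?_, ?_⟩)
  · refine (Multiset.eq_of_le_of_card_le (Multiset.le_iff_count.2 fun a => ?_) ?_).symm
    · by_cases ha : a ∈ Finset.Icc 1 n
      · rw [Multiset.count_nsmul, Multiset.count_eq_one_of_mem (Finset.nodup _) ha,
          Multiset.coe_count, hcount a (Finset.mem_Icc.1 ha).1 (Finset.mem_Icc.1 ha).2]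
      · rw [Multiset.count_nsmul, Multiset.count_eq_zero_of_notMem ha]
        simp
    · simp [hlen]
  · simpa using congrArg Multiset.card h
  · intro i h1 h2
    rw [← Multiset.coe_count, h, Multiset.count_nsmul,
      Multiset.count_eq_one_of_mem (Finset.nodup _) (Finset.mem_Icc.2 ⟨h1, h2⟩)]
  · intro h a b hs
    obtain ⟨f, hf⟩ := List.sublist_iff_exists_fin_orderEmbedding_get_eq.1 hs
    have h0 := hf ⟨0, by simp⟩
    have h1 := hf ⟨1, by simp⟩
    have h2 := hf ⟨2, by simp⟩
    have := h (f ⟨0, by simp⟩) (f ⟨1, by simp⟩) (f ⟨2, by simp⟩) (by simp) (by simp)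
      (h0.symm.trans h2)
    rwa [← h0, ← h1] at this
  · intro h p q r hpq hqr hpr
    refine h _ _ (List.sublist_iff_exists_fin_orderEmbedding_get_eq.2
      ⟨OrderEmbedding.ofStrictMono ![p, q, r] ?_, ?_⟩)
    · intro i j hij
      fin_cases i <;> fin_cases j <;> simp_all [hpq.trans hqr]
    · intro i
      fin_cases i
      exacts [rfl, rfl, hpr]

theorem IsStirlingPerm.le_of_mem {n : ℕ} {l : List ℕ} (h : IsStirlingPerm n l) {a : ℕ}
    (ha : a ∈ l) : a ≤ n := by
  rw [← Multiset.mem_coe, ((isStirlingPerm_iff n l).1 h).1] at ha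
  exact (Finset.mem_Icc.1 (Multiset.mem_of_mem_nsmul ha)).2

theorem two_nsmul_Icc_succ (n : ℕ) :
    2 • (Finset.Icc 1 (n + 1)).val = (n + 1) ::ₘ (n + 1) ::ₘ 2 • (Finset.Icc 1 n).val := by
  rw [← Finset.insert_Icc_right_eq_Icc_add_one (by omega), Finset.insert_val_of_notMem (by simp),
    ← Multiset.singleton_add, nsmul_add, two_nsmul {n + 1}, add_assoc, Multiset.singleton_add,
    Multiset.singleton_add]

theorem coe_append_cons_cons (v : ℕ) (x z : List ℕ) :
    ((x ++ v :: v :: z : List ℕ) : Multiset ℕ) = v ::ₘ v ::ₘ ((x ++ z : List ℕ) : Multiset ℕ) := by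
  simp only [Multiset.cons_coe, Multiset.coe_eq_coe]
  exact List.perm_middle.trans (List.perm_middle.cons v)

theorem isStirlingPerm_succ_append {n : ℕ} {x z : List ℕ} :
    IsStirlingPerm (n + 1) (x ++ (n + 1) :: (n + 1) :: z) ↔ IsStirlingPerm n (x ++ z) := by
  constructor
  · intro h
    rw [isStirlingPerm_iff] at h ⊢
    rw [coe_append_cons_cons, two_nsmul_Icc_succ, Multiset.cons_inj_right,
      Multiset.cons_inj_right] at h
    refine ⟨h.1, fun a b hs => h.2 a b (hs.trans ?_)⟩
    exact (List.Sublist.refl x).append (((List.Sublist.refl z).cons _).cons _)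
  · intro h
    have hlt : ∀ a ∈ x ++ z, a < n + 1 := fun a ha => Nat.lt_succ_of_le (h.le_of_mem ha)
    have hx : n + 1 ∉ x := fun hm => (hlt _ (by simp [hm])).false
    have hz : n + 1 ∉ z := fun hm => (hlt _ (by simp [hm])).false
    rw [isStirlingPerm_iff] at h ⊢
    refine ⟨by rw [coe_append_cons_cons, two_nsmul_Icc_succ, h.1], fun a b hs => ?_⟩
    have hfilter : (x ++ (n + 1) :: (n + 1) :: z).filter (· ≠ n + 1) = x ++ z := by
      rw [List.filter_append, List.filter_cons_of_neg (by simp),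
        List.filter_cons_of_neg (by simp), ← List.filter_append, List.filter_eq_self]
      intro a ha
      simpa using (hlt a ha).ne
    by_cases ha : a = n + 1
    · subst ha
      obtain ⟨l₁, l₂, hl, h₁, h₂⟩ := List.sublist_append_iff.1 hs
      cases l₁ with
      | nil =>
        rw [List.nil_append] at hl
        subst hl
        have h₃ := List.cons_sublist_cons.1 h₂
        by_cases hb : b = n + 1
        · subst hb
          exact absurd ((List.cons_sublist_cons.1 h₃).subset (by simp)) hz
        · have h₄ : [b, n + 1].Sublist z := by
            rcases List.sublist_cons_iff.1 h₃ with h₄ | ⟨r, hr, -⟩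
            · exact h₄
            · simp at hr
              exact absurd hr.1 hb
          exact absurd (h₄.subset (by simp)) hz
      | cons c t =>
        simp only [List.cons_append, List.cons.injEq] at hl
        exact absurd (h₁.subset (by simp [← hl.1])) hx
    · have hmem : ∀ c ∈ x ++ (n + 1) :: (n + 1) :: z, c ≠ n + 1 → c < n + 1 := by
        intro c hc hne
        exact hlt c (by simpa [hne] using hc)
      by_cases hb : b = n + 1
      · exact hb ▸ hmem a (hs.subset (by simp)) ha
      · apply h.2
        have := hs.filter (· ≠ n + 1)
        rwa [hfilter, List.filter_eq_self.2 (by simp [ha, hb])] at this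

theorem IsStirlingPerm.exists_eq_append {n : ℕ} {l : List ℕ} (h : IsStirlingPerm (n + 1) l) :
    ∃ x z, l = x ++ (n + 1) :: (n + 1) :: z := by
  have hcount : l.count (n + 1) = 2 := h.2.1 _ (by omega) le_rfl
  obtain ⟨x, w, rfl, hx⟩ := List.eq_append_cons_of_mem
    (List.count_pos_iff.1 (by omega : 0 < l.count (n + 1)))
  have hw : n + 1 ∈ w := by
    rw [← List.count_pos_iff]
    rw [List.count_append, List.count_eq_zero_of_not_mem hx, List.count_cons_self] at hcount
    omega
  obtain ⟨y, z, rfl⟩ := List.append_of_mem hw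
  cases y with
  | nil => exact ⟨x, z, rfl⟩
  | cons b t =>
    have hb := ((isStirlingPerm_iff _ _).1 h).2 (n + 1) b (by
      refine List.Sublist.trans ?_ (List.sublist_append_right _ _)
      simp)
    exact absurd (h.le_of_mem (a := b) (by simp)) hb.not_ge

theorem mem_stirlingPerms {n : ℕ} {l : List ℕ} : l ∈ stirlingPerms n ↔ IsStirlingPerm n l := by
  induction n generalizing l with
  | zero =>
    rw [isStirlingPerm_iff]
    constructor
    · rintro h
      obtain rfl := Finset.mem_singleton.1 h
      simp
    · intro h
      simpa [stirlingPerms] using h.1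
  | succ n ih =>
    simp only [stirlingPerms, Finset.mem_image, Finset.mem_product, Finset.mem_range, ih,
      Prod.exists]
    constructor
    · rintro ⟨m, k, ⟨hm, -⟩, rfl⟩
      exact isStirlingPerm_succ_append.2 (by rwa [List.take_append_drop])
    · intro h
      obtain ⟨x, z, rfl⟩ := h.exists_eq_append
      have h' := isStirlingPerm_succ_append.1 h
      refine ⟨x ++ z, x.length, ⟨h', ?_⟩, by simp [insertTwice]⟩
      have := h'.1
      rw [List.length_append] at this
      omega

theorem lt_succ_of_mem_stirlingPerms {n : ℕ} {l : List ℕ} (hl : l ∈ stirlingPerms n) :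
    ∀ a ∈ l, a < n + 1 :=
  fun _ ha => Nat.lt_succ_of_le ((mem_stirlingPerms.1 hl).le_of_mem ha)

theorem filter_insertTwice {v : ℕ} {l : List ℕ} (hl : v ∉ l) (k : ℕ) :
    (insertTwice v l k).filter (· ≠ v) = l := by
  rw [insertTwice, List.filter_append, List.filter_cons_of_neg (by simp),
    List.filter_cons_of_neg (by simp), ← List.filter_append, List.take_append_drop,
    List.filter_eq_self]
  intro a ha
  simpa using ne_of_mem_of_not_mem ha hl

theorem idxOf_insertTwice {v : ℕ} {l : List ℕ} (hl : v ∉ l) {k : ℕ} (hk : k ≤ l.length) :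
    (insertTwice v l k).idxOf v = k := by
  rw [insertTwice, List.idxOf_append_of_notMem fun h => hl (List.mem_of_mem_take h)]
  simp [hk]

theorem injOn_insertTwice (n : ℕ) :
    Set.InjOn (fun p : List ℕ × ℕ => insertTwice (n + 1) p.1 p.2)
      (stirlingPerms n ×ˢ Finset.range (2 * n + 1) : Finset (List ℕ × ℕ)) := by
  have key : ∀ p ∈ stirlingPerms n ×ˢ Finset.range (2 * n + 1),
      n + 1 ∉ p.1 ∧ p.2 ≤ p.1.length := by
    intro p hp
    obtain ⟨h₁, h₂⟩ := Finset.mem_product.1 hp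
    refine ⟨fun h => (lt_succ_of_mem_stirlingPerms h₁ _ h).false, ?_⟩
    rw [(mem_stirlingPerms.1 h₁).1]
    exact Nat.lt_succ_iff.1 (Finset.mem_range.1 h₂)
  intro p hp q hq hpq
  obtain ⟨hp₁, hp₂⟩ := key p hp
  obtain ⟨hq₁, hq₂⟩ := key q hq
  refine Prod.ext ?_ ?_
  · rw [← filter_insertTwice hp₁ p.2, ← filter_insertTwice hq₁ q.2]
    exact congrArg _ hpq
  · rw [← idxOf_insertTwice hp₁ hp₂, ← idxOf_insertTwice hq₁ hq₂]
    exact congrArg _ hpq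

theorem sum_stirlingPerms_succ (n : ℕ) (f : List ℕ → ℕ) :
    ∑ l ∈ stirlingPerms (n + 1), f l =
      ∑ l ∈ stirlingPerms n, ∑ k ∈ Finset.range (2 * n + 1), f (insertTwice (n + 1) l k) := by
  rw [stirlingPerms, Finset.sum_image (injOn_insertTwice n), Finset.sum_product]

theorem card_stirlingPerms_succ (n : ℕ) :
    (stirlingPerms (n + 1)).card = (2 * n + 1) * (stirlingPerms n).card := by
  rw [stirlingPerms, Finset.card_image_of_injOn (injOn_insertTwice n), Finset.card_product,
    Finset.card_range, mul_comm]

theorem card_stirlingPerms {n : ℕ} (hn : 1 ≤ n) :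
    (stirlingPerms n).card = Nat.doubleFactorial (2 * n - 1) := by
  induction n, hn using Nat.le_induction with
  | base => rfl
  | succ n hn ih =>
    rw [card_stirlingPerms_succ, ih, show 2 * (n + 1) - 1 = 2 * n - 1 + 2 by omega,
      Nat.doubleFactorial_add_two, show 2 * n - 1 + 2 = 2 * n + 1 by omega]

/-- The number of indices at which two consecutive terms of the extended sequence are related
by `R`. -/
def adjacentCount (R : ℕ → ℕ → Prop) [DecidableRel R] (l : List ℕ) : ℕ :=
  ((Finset.range (l.length + 1)).filter fun i => R (ext l i) (ext l (i + 1))).card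

theorem ext_insertTwice_of_le {v : ℕ} {l : List ℕ} {k i : ℕ} (hk : k ≤ l.length) (hi : i ≤ k) :
    ext (insertTwice v l k) i = ext l i := by
  unfold ext insertTwice
  split_ifs with h
  · rfl
  · rw [List.getD_append _ _ _ _ (by simp; omega)]
    simp only [List.getD_eq_getElem?_getD]
    rw [List.getElem?_take_of_lt (by omega)]

theorem ext_insertTwice_add {v : ℕ} {l : List ℕ} {k : ℕ} (hk : k ≤ l.length) (j : ℕ) :
    ext (insertTwice v l k) (k + 1 + j) = (v :: v :: l.drop k).getD j 0 := by
  unfold ext insertTwice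
  rw [if_neg (by omega), List.getD_append_right _ _ _ _ (by simp [hk])]
  congr 1
  grind

theorem ext_insertTwice_add_three {v : ℕ} {l : List ℕ} {k : ℕ} (hk : k ≤ l.length) (j : ℕ) :
    ext (insertTwice v l k) (k + 3 + j) = ext l (k + 1 + j) := by
  rw [show k + 3 + j = k + 1 + (j + 2) by omega, ext_insertTwice_add hk]
  simp [ext, List.getD_eq_getElem?_getD, show k + 1 + j - 1 = k + j by omega]

theorem ext_lt {v : ℕ} {l : List ℕ} (hv : 0 < v) (hl : ∀ a ∈ l, a < v) (i : ℕ) : ext l i < v := by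
  unfold ext
  split_ifs
  · exact hv
  · rcases lt_or_ge (i - 1) l.length with h | h
    · rw [List.getD_eq_getElem _ _ h]
      exact hl _ (List.getElem_mem h)
    · rwa [List.getD_eq_default _ _ h]

section

variable {R : ℕ → ℕ → Prop} [DecidableRel R]

theorem adjacentCount_insertTwice {v : ℕ}
    (hR : ∀ a b, a < v → b < v →
      (if R a v then 1 else 0) + (if R v v then 1 else 0) + (if R v b then 1 else 0) = 1)
    {l : List ℕ} (hv : 0 < v) (hl : ∀ a ∈ l, a < v) {k : ℕ} (hk : k ≤ l.length) :
    adjacentCount R (insertTwice v l k) + (if R (ext l k) (ext l (k + 1)) then 1 else 0) =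
      adjacentCount R l + 1 := by
  obtain ⟨m, hm⟩ := Nat.exists_eq_add_of_le hk
  have hlen : (insertTwice v l k).length + 1 = k + 3 + m := by
    simp [insertTwice]
    omega
  have h₁ : ext (insertTwice v l k) (k + 1) = v := ext_insertTwice_add hk 0
  have h₂ : ext (insertTwice v l k) (k + 2) = v := ext_insertTwice_add hk 1
  have h₃ : ext (insertTwice v l k) (k + 3) = ext l (k + 1) := ext_insertTwice_add_three hk 0
  have hlow : ∀ i ∈ Finset.range k,
      (if R (ext (insertTwice v l k) i) (ext (insertTwice v l k) (i + 1)) then 1 else 0) =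
        if R (ext l i) (ext l (i + 1)) then 1 else 0 := by
    intro i hi
    have := Finset.mem_range.1 hi
    rw [ext_insertTwice_of_le hk (by omega), ext_insertTwice_of_le hk (by omega)]
  have := hR _ _ (ext_lt hv hl k) (ext_lt hv hl (k + 1))
  rw [adjacentCount, adjacentCount, Finset.card_filter, Finset.card_filter, hlen, hm,
    show k + m + 1 = k + 1 + m by omega, Finset.sum_range_add _ (k + 3),
    Finset.sum_range_add _ (k + 1), Finset.sum_range_succ _ (k + 2),
    Finset.sum_range_succ _ (k + 1), Finset.sum_range_succ _ k, Finset.sum_range_succ _ k,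
    Finset.sum_congr rfl hlow]
  simp only [add_assoc (k + 3), add_assoc (k + 1), ext_insertTwice_add_three hk]
  simp only [Nat.reduceAdd, add_assoc k 1 1, add_assoc k 2 1]
  rw [h₁, h₂, h₃, ext_insertTwice_of_le hk le_rfl]
  omega

theorem sum_adjacentCount_insertTwice {v : ℕ}
    (hR : ∀ a b, a < v → b < v →
      (if R a v then 1 else 0) + (if R v v then 1 else 0) + (if R v b then 1 else 0) = 1)
    {l : List ℕ} (hv : 0 < v) (hl : ∀ a ∈ l, a < v) :
    ∑ k ∈ Finset.range (l.length + 1), adjacentCount R (insertTwice v l k) =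
      l.length * adjacentCount R l + (l.length + 1) := by
  have h := Finset.sum_congr (rfl : Finset.range (l.length + 1) = _) fun k hk =>
    adjacentCount_insertTwice hR hv hl (Nat.lt_succ_iff.1 (Finset.mem_range.1 hk))
  rw [Finset.sum_add_distrib, ← Finset.card_filter, Finset.sum_const, Finset.card_range,
    smul_eq_mul, ← adjacentCount] at h
  linarith

theorem three_mul_sum_adjacentCount
    (hR : ∀ v a b, a < v → b < v →
      (if R a v then 1 else 0) + (if R v v then 1 else 0) + (if R v b then 1 else 0) = 1)
    {n : ℕ} (hn : 1 ≤ n) :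
    3 * ∑ l ∈ stirlingPerms n, adjacentCount R l = (2 * n + 1) * (stirlingPerms n).card := by
  have hrec : ∀ m, ∑ l ∈ stirlingPerms (m + 1), adjacentCount R l =
      2 * m * ∑ l ∈ stirlingPerms m, adjacentCount R l +
        (2 * m + 1) * (stirlingPerms m).card := by
    intro m
    rw [sum_stirlingPerms_succ, Finset.mul_sum, mul_comm _ (Finset.card _),
      ← Finset.sum_const_nat (f := fun _ => 2 * m + 1) fun _ _ => rfl, ← Finset.sum_add_distrib]
    refine Finset.sum_congr rfl fun l hl => ?_
    have := sum_adjacentCount_insertTwice (hR (m + 1)) m.succ_pos (lt_succ_of_mem_stirlingPerms hl)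
    rwa [(mem_stirlingPerms.1 hl).1] at this
  induction n, hn using Nat.le_induction with
  | base => rw [hrec 0, card_stirlingPerms_succ 0]; simp [stirlingPerms]
  | succ n hn ih =>
    rw [hrec, card_stirlingPerms_succ]
    linear_combination 2 * n * ih

theorem stirlingExp_adjacentCount
    (hR : ∀ v a b, a < v → b < v →
      (if R a v then 1 else 0) + (if R v v then 1 else 0) + (if R v b then 1 else 0) = 1)
    {n : ℕ} (hn : 1 ≤ n) :
    stirlingExp n (fun l => (adjacentCount R l : ℝ)) = (2 * n + 1) / 3 := by
  have hset : {l : List ℕ | IsStirlingPerm n l} = ↑(stirlingPerms n) :=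
    Set.ext fun _ => mem_stirlingPerms.symm
  have hpos : (0 : ℝ) < (stirlingPerms n).card := by
    rw [card_stirlingPerms hn]
    exact_mod_cast Nat.doubleFactorial_pos _
  have h : (3 : ℝ) * ∑ l ∈ stirlingPerms n, (adjacentCount R l : ℝ) =
      (2 * n + 1) * (stirlingPerms n).card := by
    exact_mod_cast three_mul_sum_adjacentCount hR hn
  rw [stirlingExp, hset, finsum_mem_coe_finset, Set.ncard_coe_finset,
    div_eq_div_iff hpos.ne' three_ne_zero]
  linarith

end

/-- For every `n ≥ 1`, the expected numbers of ascents, descents and plateaux of a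
uniformly random Stirling permutation of length `2n` all equal `(2n+1)/3`;
equivalently, the sum over all Stirling permutations of length `2n` of the number of
plateaux equals `(2n+1)·(2n-1)!!/3`. -/
theorem expected_ascents_descents_plateaux (n : ℕ) (hn : 1 ≤ n) :
    stirlingExp n (fun l => (ascents l : ℝ)) = (2 * n + 1) / 3 ∧
    stirlingExp n (fun l => (descents l : ℝ)) = (2 * n + 1) / 3 ∧
    stirlingExp n (fun l => (plateaux l : ℝ)) = (2 * n + 1) / 3 ∧
    3 * (∑ᶠ l ∈ {l : List ℕ | IsStirlingPerm n l}, plateaux l)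
      = (2 * n + 1) * Nat.doubleFactorial (2 * n - 1) := by
  have hplat : ∀ v a b : ℕ, a < v → b < v →
      (if a = v then 1 else 0) + (if v = v then 1 else 0) + (if v = b then 1 else 0) = 1 := by
    intro v a b ha hb
    simp [ha.ne, hb.ne']
  refine ⟨stirlingExp_adjacentCount (R := (· < ·)) ?_ hn,
    stirlingExp_adjacentCount (R := (· > ·)) ?_ hn,
    stirlingExp_adjacentCount (R := (· = ·)) hplat hn, ?_⟩
  · intro v a b ha hb
    simp [ha, hb.le]
  · intro v a b ha hb
    simp [ha.le, hb]
  · have hset : {l : List ℕ | IsStirlingPerm n l} = ↑(stirlingPerms n) :=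
      Set.ext fun _ => mem_stirlingPerms.symm
    rw [hset, finsum_mem_coe_finset, ← card_stirlingPerms hn]
    exact three_mul_sum_adjacentCount (R := (· = ·)) hplat hn
end

section
/- For every n ≥ 1, the covariances between the numbers of ascents, descents and plateaux of a uniformly random Stirling permutation of length 2n satisfy Cov(X_n, Y_n) = Cov(X_n, Z_n) = Cov(Y_n, Z_n) = -(n²-1)/(9(2n-1)). -/
/-- The variance of a statistic `f` under the uniform distribution on the set of
Stirling permutations of length `2n`. -/
noncomputable def stirlingVar (n : ℕ) (f : List ℕ → ℝ) : ℝ :=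
  stirlingExp n (fun l => (f l - stirlingExp n f) ^ 2)

/-- The covariance of two statistics `f`, `g` under the uniform distribution on the
set of Stirling permutations of length `2n`. -/
noncomputable def stirlingCov (n : ℕ) (f g : List ℕ → ℝ) : ℝ :=
  stirlingExp n (fun l => (f l - stirlingExp n f) * (g l - stirlingExp n g))

open Finset hiding ext

/-- The number of indices `i` at which consecutive entries of `0, l, 0` are related by `R`. -/
def gapCount (R : ℕ → ℕ → Prop) [DecidableRel R] (l : List ℕ) : ℕ :=
  ((range (l.length + 1)).filter (fun i => R (ext l i) (ext l (i + 1)))).card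

/-- Insert two adjacent copies of `m` at position `p.2` of the list `p.1`. -/
def insertPair (m : ℕ) (p : List ℕ × ℕ) : List ℕ :=
  p.1.take p.2 ++ m :: m :: p.1.drop p.2

/-- The finite set of Stirling permutations of length `2 * n`, generated by inserting pairs. -/
def stirlingFinset : ℕ → Finset (List ℕ)
  | 0 => {[]}
  | n + 1 => (stirlingFinset n ×ˢ range (2 * n + 1)).image (insertPair (n + 1))

lemma forall_fin_get_iff_sublist (l : List ℕ) :
    (∀ p q r : Fin l.length, p < q → q < r → l.get p = l.get r → l.get p < l.get q) ↔
      ∀ x y, [x, y, x].Sublist l → x < y := by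
  constructor
  · intro h x y hs
    obtain ⟨f, hf⟩ := List.sublist_iff_exists_fin_orderEmbedding_get_eq.1 hs
    have h0 := hf ⟨0, by simp⟩
    have h1 := hf ⟨1, by simp⟩
    have h2 := hf ⟨2, by simp⟩
    have := h (f ⟨0, by simp⟩) (f ⟨1, by simp⟩) (f ⟨2, by simp⟩) (by simp) (by simp)
      (by rw [← h0, ← h2]; rfl)
    rw [← h0, ← h1] at this
    exact this
  · intro h p q r hpq hqr he
    apply h
    have hs : ([p, q, r].map (l[·])).Sublist l := by
      apply List.map_getElem_sublist
      simp [hpq, hqr, hpq.trans hqr]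
    simp only [List.get_eq_getElem] at he
    simpa [← he] using hs

lemma mem_bounds_of_isStirlingPerm {n : ℕ} {l : List ℕ} (h : IsStirlingPerm n l) {x : ℕ}
    (hx : x ∈ l) : 1 ≤ x ∧ x ≤ n := by
  obtain ⟨hlen, hcount, -⟩ := h
  by_contra hne
  have hsub : Icc 1 n ⊆ l.toFinset := by
    intro i hi
    rw [mem_Icc] at hi
    rw [List.mem_toFinset, ← List.count_pos_iff, hcount i hi.1 hi.2]
    norm_num
  have hlt : ∑ i ∈ Icc 1 n, l.count i < ∑ i ∈ l.toFinset, l.count i :=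
    sum_lt_sum_of_subset hsub (List.mem_toFinset.2 hx) (by simpa using hne)
      (List.count_pos_iff.2 hx) (fun _ _ _ => Nat.zero_le _)
  rw [List.sum_toFinset_count_eq_length, hlen,
    sum_congr rfl (fun i hi => hcount i (mem_Icc.1 hi).1 (mem_Icc.1 hi).2)] at hlt
  simp at hlt
  omega

lemma not_sublist_append_pair {m y : ℕ} {a c : List ℕ} (ha : m ∉ a) (hc : m ∉ c) :
    ¬ [m, y, m].Sublist (a ++ m :: m :: c) := by
  induction a with
  | nil =>
    intro h
    have h1 : [y, m].Sublist (m :: c) := by simpa using h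
    rcases List.sublist_cons_iff.1 h1 with h2 | ⟨r, hr, h2⟩
    · exact hc (h2.subset (by simp))
    · simp only [List.cons.injEq] at hr
      rw [← hr.2] at h2
      exact hc (h2.subset (by simp))
  | cons b t ih =>
    intro h
    simp only [List.mem_cons, not_or] at ha
    rw [List.cons_append] at h
    rcases List.sublist_cons_iff.1 h with h2 | ⟨r, hr, h2⟩
    · exact ih ha.2 h2
    · simp only [List.cons.injEq] at hr
      exact ha.1 hr.1

lemma isStirlingPerm_append_pair {n : ℕ} {a c : List ℕ} (h : IsStirlingPerm n (a ++ c)) :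
    IsStirlingPerm (n + 1) (a ++ (n + 1) :: (n + 1) :: c) := by
  have hb : ∀ x ∈ a ++ c, x ≠ n + 1 := fun x hx => by
    have := mem_bounds_of_isStirlingPerm h hx
    omega
  have ha : n + 1 ∉ a := fun hx => hb _ (List.mem_append_left _ hx) rfl
  have hc : n + 1 ∉ c := fun hx => hb _ (List.mem_append_right _ hx) rfl
  have hle : ∀ x ∈ a ++ (n + 1) :: (n + 1) :: c, x ≤ n + 1 := by
    intro x hx
    have hx' : x = n + 1 ∨ x ∈ a ++ c := by
      simp only [List.mem_append, List.mem_cons] at hx ⊢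
      tauto
    rcases hx' with rfl | hx'
    · exact le_rfl
    · exact (mem_bounds_of_isStirlingPerm h hx').2.trans (Nat.le_succ n)
  obtain ⟨hlen, hcount, hs⟩ := h
  rw [forall_fin_get_iff_sublist] at hs
  refine ⟨by simp only [List.length_append, List.length_cons] at hlen ⊢; omega, ?_, ?_⟩
  · intro i h1 h2
    rcases eq_or_ne i (n + 1) with rfl | hi
    · simp [List.count_append, List.count_eq_zero_of_not_mem ha,
        List.count_eq_zero_of_not_mem hc]
    · have := hcount i h1 (by omega)
      simpa [List.count_append, List.count_cons, hi.symm] using this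
  · rw [forall_fin_get_iff_sublist]
    intro x y hxy
    have hx : x ≠ n + 1 := by
      rintro rfl
      exact not_sublist_append_pair ha hc hxy
    have hxle := hle x (hxy.subset (by simp))
    rcases eq_or_ne y (n + 1) with rfl | hy
    · omega
    · apply hs
      have hf := hxy.filter (fun z => decide (z ≠ n + 1))
      have hfa : (a ++ c).filter (fun z => decide (z ≠ n + 1)) = a ++ c :=
        List.filter_eq_self.2 (fun z hz => by simpa using hb z hz)
      rw [List.filter_append] at hfa
      simpa [List.filter_append, hx, hy, ← hfa] using hf

lemma exists_append_pair_of_isStirlingPerm {n : ℕ} {l : List ℕ}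
    (h : IsStirlingPerm (n + 1) l) :
    ∃ a c, l = a ++ (n + 1) :: (n + 1) :: c ∧ IsStirlingPerm n (a ++ c) := by
  have hle : ∀ x ∈ l, x ≤ n + 1 := fun x hx => (mem_bounds_of_isStirlingPerm h hx).2
  obtain ⟨hlen, hcount, hs⟩ := h
  rw [forall_fin_get_iff_sublist] at hs
  have hm := hcount (n + 1) (by omega) le_rfl
  have hmem : n + 1 ∈ l := List.count_pos_iff.1 (by omega)
  obtain ⟨a, t, rfl, hat⟩ := List.eq_append_cons_of_mem hmem
  have hmt : n + 1 ∈ t := by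
    rw [List.count_append, List.count_cons_self, List.count_eq_zero_of_not_mem hat] at hm
    exact List.count_pos_iff.1 (by omega)
  obtain ⟨b, c, rfl, hbc⟩ := List.eq_append_cons_of_mem hmt
  obtain rfl : b = [] := by
    rcases b with _ | ⟨y, b⟩
    · rfl
    · have h1 := hs (n + 1) y (by
        refine List.Sublist.trans ?_ (List.sublist_append_right _ _)
        simp)
      have h2 := hle y (by simp)
      omega
  refine ⟨a, c, rfl, ?_, ?_, ?_⟩
  · simp only [List.nil_append, List.length_append, List.length_cons] at hlen ⊢
    omega
  · intro i h1 h2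
    have := hcount i h1 (by omega)
    have hi : n + 1 ≠ i := by omega
    simpa [List.count_append, List.count_cons, hi] using this
  · rw [forall_fin_get_iff_sublist]
    intro x y hxy
    refine hs x y (hxy.trans ?_)
    exact List.Sublist.append_left (by simp) a

lemma mem_stirlingFinset {n : ℕ} {l : List ℕ} : l ∈ stirlingFinset n ↔ IsStirlingPerm n l := by
  induction n generalizing l with
  | zero =>
    simp only [stirlingFinset, mem_singleton]
    constructor
    · rintro rfl
      exact ⟨rfl, fun i _ _ => by omega, fun p => p.elim0⟩
    · intro h
      exact List.length_eq_zero_iff.1 h.1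
  | succ n ih =>
    simp only [stirlingFinset, mem_image, mem_product, Prod.exists, ih, mem_range]
    constructor
    · rintro ⟨k, i, ⟨hk, -⟩, rfl⟩
      apply isStirlingPerm_append_pair
      simpa using hk
    · intro h
      obtain ⟨a, c, rfl, hac⟩ := exists_append_pair_of_isStirlingPerm h
      refine ⟨a ++ c, a.length, ⟨hac, ?_⟩, by simp [insertPair]⟩
      have := hac.1
      rw [List.length_append] at this
      omega

lemma injOn_insertPair (n : ℕ) :
    Set.InjOn (insertPair (n + 1)) (stirlingFinset n ×ˢ range (2 * n + 1) : Finset _) := by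
  have key : ∀ k i, k ∈ stirlingFinset n → i < 2 * n + 1 →
      (insertPair (n + 1) (k, i)).filter (fun z => decide (z ≠ n + 1)) = k ∧
      (insertPair (n + 1) (k, i)).idxOf (n + 1) = i := by
    intro k i hk hi
    rw [mem_stirlingFinset] at hk
    have hb : ∀ x ∈ k, x ≠ n + 1 := fun x hx => by
      have := mem_bounds_of_isStirlingPerm hk hx
      omega
    constructor
    · have hfa : k.filter (fun z => decide (z ≠ n + 1)) = k :=
        List.filter_eq_self.2 (fun z hz => by simpa using hb z hz)
      conv_rhs => rw [← hfa, ← List.take_append_drop i k]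
      rw [insertPair, List.filter_append, List.filter_append]
      simp
    · rw [insertPair, List.idxOf_append_of_notMem
        (fun hx => hb _ (List.mem_of_mem_take hx) rfl)]
      have := hk.1
      simp
      omega
  rintro ⟨k, i⟩ hki ⟨k', i'⟩ hki' he
  simp only [coe_product, Set.mem_prod, mem_coe, mem_range] at hki hki'
  have h1 := key k i hki.1 hki.2
  have h2 := key k' i' hki'.1 hki'.2
  rw [he] at h1
  exact Prod.ext (h1.1.symm.trans h2.1) (h1.2.symm.trans h2.2)

lemma sum_stirlingFinset_succ (n : ℕ) (f : List ℕ → ℝ) :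
    ∑ l ∈ stirlingFinset (n + 1), f l =
      ∑ l ∈ stirlingFinset n, ∑ i ∈ range (2 * n + 1), f (insertPair (n + 1) (l, i)) := by
  rw [stirlingFinset, sum_image (injOn_insertPair n), sum_product]

lemma ext_lt_of_isStirlingPerm {n : ℕ} {l : List ℕ} (h : IsStirlingPerm n l) (i : ℕ) :
    ext l i < n + 1 := by
  unfold ext
  split_ifs
  · omega
  · by_cases hi : i - 1 < l.length
    · rw [List.getD_eq_getElem _ _ hi]
      have := (mem_bounds_of_isStirlingPerm h (List.getElem_mem hi)).2
      omega
    · rw [List.getD_eq_default _ _ (by omega)]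
      omega

lemma ext_insertPair_of_le {m i j : ℕ} {l : List ℕ} (hi : i ≤ l.length) (hj : j ≤ i) :
    ext (insertPair m (l, i)) j = ext l j := by
  unfold ext insertPair
  split_ifs with h
  · rfl
  · simp only [List.getD_eq_getElem?_getD]
    rw [List.getElem?_append_left (by simp; omega), List.getElem?_take_of_lt (by omega)]

lemma ext_insertPair_add_one {m i : ℕ} {l : List ℕ} (hi : i ≤ l.length) :
    ext (insertPair m (l, i)) (i + 1) = m := by
  simp [ext, insertPair, hi]

lemma ext_insertPair_add_two {m i : ℕ} {l : List ℕ} (hi : i ≤ l.length) :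
    ext (insertPair m (l, i)) (i + 2) = m := by
  simp [ext, insertPair, hi]

lemma ext_insertPair_add_three {m i : ℕ} (j : ℕ) {l : List ℕ} (hi : i ≤ l.length) :
    ext (insertPair m (l, i)) (i + 3 + j) = ext l (i + 1 + j) := by
  have h1 : i + 3 + j - 1 = i + (j + 2) := by omega
  have h2 : i + 1 + j - 1 = i + j := by omega
  have h3 : i + (j + 2) - i = j + 2 := by omega
  simp [ext, insertPair, List.getElem?_append_right, hi, h1, h2, h3]

lemma sum_range_add_of_replace {M : Type*} [AddCommMonoid M] {f g : ℕ → M} {i N : ℕ}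
    (hi : i < N) (h₁ : ∀ j < i, g j = f j) (h₂ : ∀ j, g (i + 3 + j) = f (i + 1 + j)) :
    ∑ j ∈ range (N + 2), g j + f i =
      ∑ j ∈ range N, f j + (g i + g (i + 1) + g (i + 2)) := by
  obtain ⟨k, rfl⟩ : ∃ k, N = i + 1 + k := ⟨N - (i + 1), by omega⟩
  rw [show i + 1 + k + 2 = i + 3 + k by ring, sum_range_add, sum_range_add (n := i + 1),
    sum_range_succ, sum_range_succ, sum_range_succ, sum_range_succ,
    sum_congr rfl (fun j hj => h₁ j (mem_range.1 hj)), sum_congr rfl (fun j _ => h₂ j)]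
  abel

section GapCount

variable (R S : ℕ → ℕ → Prop) [DecidableRel R] [DecidableRel S]

lemma gapCount_eq_sum (l : List ℕ) :
    (gapCount R l : ℝ) =
      ∑ i ∈ range (l.length + 1), if R (ext l i) (ext l (i + 1)) then 1 else 0 := by
  rw [gapCount, card_filter]
  push_cast
  rfl

variable {R S}

/-- Exactly one of the three gaps created by inserting the pair `m m` between smaller
numbers satisfies `R`. -/
def CreatesOneGap (R : ℕ → ℕ → Prop) [DecidableRel R] : Prop :=
  ∀ u v m, u < m → v < m →
    (if R u m then 1 else 0) + (if R m m then 1 else 0) + (if R m v then 1 else 0) = (1 : ℝ)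

lemma gapCount_insertPair (hR : CreatesOneGap R) {n i : ℕ} {l : List ℕ}
    (h : IsStirlingPerm n l) (hi : i < 2 * n + 1) :
    (gapCount R (insertPair (n + 1) (l, i)) : ℝ) =
      gapCount R l + 1 - if R (ext l i) (ext l (i + 1)) then 1 else 0 := by
  have hil : i ≤ l.length := by rw [h.1]; omega
  have hlen : (insertPair (n + 1) (l, i)).length + 1 = l.length + 1 + 2 := by
    simp only [insertPair, List.length_append, List.length_cons, List.length_take,
      List.length_drop]
    omega
  have hsum := sum_range_add_of_replace (M := ℝ) (i := i) (N := l.length + 1)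
    (f := fun j => if R (ext l j) (ext l (j + 1)) then 1 else 0)
    (g := fun j => if R (ext (insertPair (n + 1) (l, i)) j)
      (ext (insertPair (n + 1) (l, i)) (j + 1)) then 1 else 0)
    (by omega)
    (fun j hj => by
      simp only [ext_insertPair_of_le hil hj.le, ext_insertPair_of_le hil (show j + 1 ≤ i from hj)])
    (fun j => by
      simp only [add_assoc _ j 1, ext_insertPair_add_three _ hil])
  have hone := hR (ext l i) (ext l (i + 1)) (n + 1) (ext_lt_of_isStirlingPerm h _)
    (ext_lt_of_isStirlingPerm h _)
  have h3 : ext (insertPair (n + 1) (l, i)) (i + 2 + 1) = ext l (i + 1) :=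
    ext_insertPair_add_three 0 hil
  simp only [ext_insertPair_of_le hil le_rfl, ext_insertPair_add_one hil,
    show i + 1 + 1 = i + 2 from rfl, ext_insertPair_add_two hil, h3] at hsum
  rw [hone] at hsum
  rw [gapCount_eq_sum, gapCount_eq_sum, hlen]
  linarith

lemma sum_gapCount_insertPair (hR : CreatesOneGap R) {n : ℕ} {l : List ℕ}
    (h : IsStirlingPerm n l) :
    ∑ i ∈ range (2 * n + 1), (gapCount R (insertPair (n + 1) (l, i)) : ℝ) =
      2 * n * gapCount R l + (2 * n + 1) := by
  rw [sum_congr rfl (fun i hi => gapCount_insertPair hR h (mem_range.1 hi)), sum_sub_distrib,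
    ← h.1, ← gapCount_eq_sum, h.1]
  simp only [sum_const, card_range, nsmul_eq_mul]
  push_cast
  ring

lemma sum_gapCount_mul_insertPair (hR : CreatesOneGap R) (hS : CreatesOneGap S)
    (hRS : ∀ u v, R u v → ¬ S u v) {n : ℕ} {l : List ℕ} (h : IsStirlingPerm n l) :
    ∑ i ∈ range (2 * n + 1), (gapCount R (insertPair (n + 1) (l, i)) : ℝ) *
        gapCount S (insertPair (n + 1) (l, i)) =
      (2 * n - 1) * (gapCount R l * gapCount S l) + 2 * n * gapCount R l +
        2 * n * gapCount S l + (2 * n + 1) := by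
  have hterm : ∀ i ∈ range (2 * n + 1), (gapCount R (insertPair (n + 1) (l, i)) : ℝ) *
        gapCount S (insertPair (n + 1) (l, i)) =
      ((gapCount R l : ℝ) + 1) * (gapCount S l + 1) -
        (gapCount S l + 1) * (if R (ext l i) (ext l (i + 1)) then 1 else 0) -
        (gapCount R l + 1) * (if S (ext l i) (ext l (i + 1)) then 1 else 0) := by
    intro i hi
    rw [gapCount_insertPair hR h (mem_range.1 hi), gapCount_insertPair hS h (mem_range.1 hi)]
    have := hRS (ext l i) (ext l (i + 1))
    split_ifs <;> first | tauto | ring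
  rw [sum_congr rfl hterm, sum_sub_distrib, sum_sub_distrib, sum_const, ← mul_sum, ← mul_sum,
    ← h.1, ← gapCount_eq_sum, ← gapCount_eq_sum, h.1]
  simp only [card_range, nsmul_eq_mul]
  push_cast
  ring

lemma card_stirlingFinset_succ (n : ℕ) :
    ((stirlingFinset (n + 1)).card : ℝ) = (2 * n + 1) * (stirlingFinset n).card := by
  rw [stirlingFinset, card_image_of_injOn (injOn_insertPair n), card_product, card_range]
  push_cast
  ring

lemma card_stirlingFinset_pos (n : ℕ) : (0 : ℝ) < (stirlingFinset n).card := by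
  induction n with
  | zero => simp [stirlingFinset]
  | succ n ih =>
    rw [card_stirlingFinset_succ]
    positivity

lemma sum_gapCount_succ (hR : CreatesOneGap R) (n : ℕ) :
    ∑ l ∈ stirlingFinset (n + 1), (gapCount R l : ℝ) =
      2 * n * ∑ l ∈ stirlingFinset n, (gapCount R l : ℝ) +
        (2 * n + 1) * (stirlingFinset n).card := by
  rw [sum_stirlingFinset_succ,
    sum_congr rfl (fun l hl => sum_gapCount_insertPair hR (mem_stirlingFinset.1 hl)),
    sum_add_distrib, ← mul_sum, sum_const, nsmul_eq_mul]
  ring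

lemma sum_gapCount_mul_succ (hR : CreatesOneGap R) (hS : CreatesOneGap S)
    (hRS : ∀ u v, R u v → ¬ S u v) (n : ℕ) :
    ∑ l ∈ stirlingFinset (n + 1), (gapCount R l : ℝ) * gapCount S l =
      (2 * n - 1) * ∑ l ∈ stirlingFinset n, (gapCount R l : ℝ) * gapCount S l +
        2 * n * ∑ l ∈ stirlingFinset n, (gapCount R l : ℝ) +
        2 * n * ∑ l ∈ stirlingFinset n, (gapCount S l : ℝ) +
        (2 * n + 1) * (stirlingFinset n).card := by
  rw [sum_stirlingFinset_succ,
    sum_congr rfl (fun l hl => sum_gapCount_mul_insertPair hR hS hRS (mem_stirlingFinset.1 hl)),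
    sum_add_distrib, sum_add_distrib, sum_add_distrib, ← mul_sum, ← mul_sum, ← mul_sum,
    sum_const, nsmul_eq_mul]
  ring

lemma sum_gapCount (hR : CreatesOneGap R) {n : ℕ} (hn : 1 ≤ n) :
    ∑ l ∈ stirlingFinset n, (gapCount R l : ℝ) =
      (stirlingFinset n).card * ((2 * n + 1) / 3) := by
  induction n, hn using Nat.le_induction with
  | base =>
    rw [sum_gapCount_succ hR 0, card_stirlingFinset_succ]
    norm_num
  | succ n hn ih =>
    rw [sum_gapCount_succ hR n, ih, card_stirlingFinset_succ]
    push_cast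
    ring

lemma sum_gapCount_mul (hR : CreatesOneGap R) (hS : CreatesOneGap S)
    (hRS : ∀ u v, R u v → ¬ S u v) {n : ℕ} (hn : 1 ≤ n) :
    ∑ l ∈ stirlingFinset n, (gapCount R l : ℝ) * gapCount S l =
      (stirlingFinset n).card *
        (((2 * n + 1) / 3) ^ 2 + -((n : ℝ) ^ 2 - 1) / (9 * (2 * n - 1))) := by
  induction n, hn using Nat.le_induction with
  | base =>
    rw [sum_gapCount_mul_succ hR hS hRS 0, card_stirlingFinset_succ]
    have := hRS 0 0
    by_cases h : R 0 0 <;> by_cases h' : S 0 0 <;>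
      simp_all [stirlingFinset, gapCount, ext] <;> norm_num
  | succ n hn ih =>
    rw [sum_gapCount_mul_succ hR hS hRS n, ih, sum_gapCount hR hn, sum_gapCount hS hn,
      card_stirlingFinset_succ]
    have hn' : (1 : ℝ) ≤ n := by exact_mod_cast hn
    have h1 : (2 * n - 1 : ℝ) ≠ 0 := by linarith
    have h2 : (2 * (n + 1) - 1 : ℝ) ≠ 0 := by linarith
    push_cast
    field_simp
    ring

lemma stirlingExp_eq (n : ℕ) (f : List ℕ → ℝ) :
    stirlingExp n f = (∑ l ∈ stirlingFinset n, f l) / (stirlingFinset n).card := by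
  have hset : {l : List ℕ | IsStirlingPerm n l} = (stirlingFinset n : Set (List ℕ)) := by
    ext l
    simp [mem_stirlingFinset]
  rw [stirlingExp, hset, Set.ncard_coe_finset, finsum_mem_coe_finset]

lemma stirlingCov_gapCount (hR : CreatesOneGap R) (hS : CreatesOneGap S)
    (hRS : ∀ u v, R u v → ¬ S u v) {n : ℕ} (hn : 1 ≤ n) :
    stirlingCov n (fun l => (gapCount R l : ℝ)) (fun l => (gapCount S l : ℝ)) =
      -((n : ℝ) ^ 2 - 1) / (9 * (2 * n - 1)) := by
  have hc := (card_stirlingFinset_pos n).ne'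
  rw [stirlingCov, stirlingExp_eq, stirlingExp_eq, stirlingExp_eq, sum_gapCount hR hn,
    sum_gapCount hS hn, mul_div_cancel_left₀ _ hc]
  simp only [sub_mul, mul_sub, sum_sub_distrib, ← mul_sum, ← sum_mul, sum_const, nsmul_eq_mul]
  rw [sum_gapCount_mul hR hS hRS hn, sum_gapCount hR hn, sum_gapCount hS hn, div_eq_iff hc]
  ring

end GapCount

lemma createsOneGap_lt : CreatesOneGap (fun a b => a < b) := by
  intro u v m hu hv
  simp [hu, hv.le]

lemma createsOneGap_gt : CreatesOneGap (fun a b => a > b) := by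
  intro u v m hu hv
  simp [hv, hu.le]

lemma createsOneGap_eq : CreatesOneGap (fun a b => a = b) := by
  intro u v m hu hv
  simp [hu.ne, hv.ne']

/-- For every `n ≥ 1`, the covariances between the numbers of ascents, descents and
plateaux of a uniformly random Stirling permutation of length `2n` satisfy
`Cov(X_n,Y_n) = Cov(X_n,Z_n) = Cov(Y_n,Z_n) = -(n²-1)/(9(2n-1))`. -/
theorem cov_ascents_descents_plateaux (n : ℕ) (hn : 1 ≤ n) :
    stirlingCov n (fun l => (ascents l : ℝ)) (fun l => (descents l : ℝ))
      = -((n : ℝ) ^ 2 - 1) / (9 * (2 * n - 1)) ∧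
    stirlingCov n (fun l => (ascents l : ℝ)) (fun l => (plateaux l : ℝ))
      = -((n : ℝ) ^ 2 - 1) / (9 * (2 * n - 1)) ∧
    stirlingCov n (fun l => (descents l : ℝ)) (fun l => (plateaux l : ℝ))
      = -((n : ℝ) ^ 2 - 1) / (9 * (2 * n - 1)) := by
  exact ⟨stirlingCov_gapCount createsOneGap_lt createsOneGap_gt (fun _ _ h => h.le.not_gt) hn,
    stirlingCov_gapCount createsOneGap_lt createsOneGap_eq (fun _ _ h => h.ne) hn,
    stirlingCov_gapCount createsOneGap_gt createsOneGap_eq (fun _ _ h => h.ne') hn⟩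
end
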